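/- The hazard rate of the standard normal distribution is strictly increasing: for all real numbers x < y, one has φ(x)/(1 - Φ(x)) < φ(y)/(1 - Φ(y)), where φ is the standard normal density and Φ is the standard normal cumulative distribution function. Equivalently, φ(x)·(1 - Φ(y)) < φ(y)·(1 - Φ(x)) for all x < y. -/

import Mathlib

open Real MeasureTheory

/-- The probability density function of the standard normal distribution. -/
noncomputable def stdNormalPDF (x : ℝ) : ℝ :=
  (Real.sqrt (2 * Real.pi))⁻¹ * Real.exp (-x ^ 2 / 2)

/-- The cumulative distribution function of the standard normal distribution. -/
noncomputable def stdNormalCDF (x : ℝ) : ℝ :=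
  ∫ t in Set.Iic x, stdNormalPDF t

theorem stdNormalPDF_eq_gaussianPDFReal :
    stdNormalPDF = ProbabilityTheory.gaussianPDFReal 0 1 := by
  ext x
  simp [stdNormalPDF, ProbabilityTheory.gaussianPDFReal]

theorem stdNormalPDF_pos (x : ℝ) : 0 < stdNormalPDF x := by
  unfold stdNormalPDF
  positivity

theorem integrable_stdNormalPDF : Integrable stdNormalPDF := by
  rw [stdNormalPDF_eq_gaussianPDFReal]
  exact ProbabilityTheory.integrable_gaussianPDFReal 0 1

theorem integral_stdNormalPDF : ∫ t, stdNormalPDF t = 1 := by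
  rw [stdNormalPDF_eq_gaussianPDFReal]
  exact ProbabilityTheory.integral_gaussianPDFReal_eq_one 0 one_ne_zero

theorem setIntegral_Ioi_pos_of_forall_pos {f : ℝ → ℝ} {a : ℝ}
    (hf : IntegrableOn f (Set.Ioi a)) (hpos : ∀ t ∈ Set.Ioi a, 0 < f t) :
    0 < ∫ t in Set.Ioi a, f t := by
  rw [setIntegral_pos_iff_support_of_nonneg_ae
    (ae_restrict_of_forall_mem measurableSet_Ioi fun t ht => (hpos t ht).le) hf,
    Set.inter_eq_right.mpr fun t ht => Function.mem_support.mpr (hpos t ht).ne']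
  simp

/-- The upper tail of the standard normal, with the integration range shifted to `(0, ∞)`. -/
theorem one_sub_stdNormalCDF (x : ℝ) :
    1 - stdNormalCDF x = ∫ u in Set.Ioi (0 : ℝ), stdNormalPDF (u + x) := by
  have h := intervalIntegral.integral_Iic_add_Ioi (b := x)
    integrable_stdNormalPDF.integrableOn integrable_stdNormalPDF.integrableOn
  rw [integral_stdNormalPDF] at h
  have hshift := (measurePreserving_add_right volume x).setIntegral_preimage_emb
    (measurableEmbedding_addRight x) stdNormalPDF (Set.Ioi x)
  rw [Set.preimage_add_const_Ioi, sub_self] at hshift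
  rw [hshift, stdNormalCDF]
  linarith

theorem integrableOn_stdNormalPDF_add (x : ℝ) (s : Set ℝ) :
    IntegrableOn (fun u => stdNormalPDF (u + x)) s :=
  (integrable_stdNormalPDF.comp_add_right x).integrableOn

theorem one_sub_stdNormalCDF_pos (x : ℝ) : 0 < 1 - stdNormalCDF x := by
  rw [one_sub_stdNormalCDF]
  exact setIntegral_Ioi_pos_of_forall_pos (integrableOn_stdNormalPDF_add x _)
    fun t _ => stdNormalPDF_pos _

/-- Strict log-concavity of the standard normal density, in product form. -/
theorem stdNormalPDF_mul_add_lt {x y u : ℝ} (hxy : x < y) (hu : 0 < u) :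
    stdNormalPDF x * stdNormalPDF (u + y) < stdNormalPDF y * stdNormalPDF (u + x) := by
  unfold stdNormalPDF
  rw [mul_mul_mul_comm _ _ _ (Real.exp (-(u + y) ^ 2 / 2)),
    mul_mul_mul_comm _ _ _ (Real.exp (-(u + x) ^ 2 / 2)), ← Real.exp_add, ← Real.exp_add]
  gcongr ?_ * Real.exp ?_
  nlinarith [mul_pos hu (sub_pos.mpr hxy)]

theorem stdNormalPDF_mul_one_sub_stdNormalCDF_lt {x y : ℝ} (hxy : x < y) :
    stdNormalPDF x * (1 - stdNormalCDF y) < stdNormalPDF y * (1 - stdNormalCDF x) := by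
  have hy := (integrableOn_stdNormalPDF_add y (Set.Ioi 0)).const_mul (stdNormalPDF x)
  have hx := (integrableOn_stdNormalPDF_add x (Set.Ioi 0)).const_mul (stdNormalPDF y)
  rw [one_sub_stdNormalCDF, one_sub_stdNormalCDF, ← integral_const_mul, ← integral_const_mul,
    ← sub_pos, ← integral_sub hx hy]
  exact setIntegral_Ioi_pos_of_forall_pos (hx.sub hy)
    fun u hu => sub_pos.mpr (stdNormalPDF_mul_add_lt hxy hu)


/-- The hazard rate of the standard normal distribution is strictly increasing:
for all `x < y`, `φ(x)/(1 - Φ(x)) < φ(y)/(1 - Φ(y))`, equivalently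
`φ(x)·(1 - Φ(y)) < φ(y)·(1 - Φ(x))`. -/
theorem stdNormal_hazard_strictMono (x y : ℝ) (hxy : x < y) :
    stdNormalPDF x / (1 - stdNormalCDF x) < stdNormalPDF y / (1 - stdNormalCDF y) ∧
    stdNormalPDF x * (1 - stdNormalCDF y) < stdNormalPDF y * (1 - stdNormalCDF x) := by
  have h := stdNormalPDF_mul_one_sub_stdNormalCDF_lt hxy
  exact ⟨(div_lt_div_iff₀ (one_sub_stdNormalCDF_pos x) (one_sub_stdNormalCDF_pos y)).mpr h, h⟩
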